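/- Let L > 0, B ≥ 0, ε₂ ≥ 0 and let F : ℝ^{m₁×m₂} × ℝ → ℝ^{m₁×m₂} satisfy ‖F(Y,s) − F(Z,t)‖_F ≤ L‖Y−Z‖_F + L|s−t| and ‖F(Y,t)‖_F ≤ B for all Y, Z, s, t. Let 0 ≤ Δt ≤ 1/(2L), let X : ℝ → ℝ^{m₁×m₂} be differentiable with X′(t) = F(X(t),t) on [tⁿ, tⁿ+Δt] and X(tⁿ) = X̂ⁿ. Let Ũ, Ṽ have orthonormal columns with Ũ Ũᵀ X̂ⁿ Ṽ Ṽᵀ = X̂ⁿ and Ũ Ũᵀ F(X̂ⁿ, tⁿ) Ṽ Ṽᵀ = F(X̂ⁿ, tⁿ), let Σ̃ satisfy Σ̃ = Ũᵀ (X̂ⁿ + Δt · F(Ũ Σ̃ Ṽᵀ, tⁿ+Δt)) Ṽ, and let X̂ⁿ⁺¹ be any matrix with ‖X̂ⁿ⁺¹ − Ũ Σ̃ Ṽᵀ‖_F ≤ ε₂ (e.g. the ε₂-truncated SVD of Ũ Σ̃ Ṽᵀ). Then ‖X(tⁿ + Δt) − X̂ⁿ⁺¹‖_F ≤ 4 Δt²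 L (B + 1) + ε₂. -/

import Mathlib

open Matrix

/-- Frobenius inner product of two real matrices. -/
noncomputable def finner {m₁ m₂ : ℕ} (A B : Matrix (Fin m₁) (Fin m₂) ℝ) : ℝ :=
  ∑ i, ∑ j, A i j * B i j

/-- Frobenius norm of a real matrix. -/
noncomputable def fnorm {m₁ m₂ : ℕ} (A : Matrix (Fin m₁) (Fin m₂) ℝ) : ℝ :=
  Real.sqrt (finner A A)

lemma finner_eq_trace {m₁ m₂ : ℕ} (A B : Matrix (Fin m₁) (Fin m₂) ℝ) :
    finner A B = (Aᵀ * B).trace := by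
  simp only [finner, Matrix.trace, Matrix.diag, Matrix.mul_apply, Matrix.transpose_apply]
  exact Finset.sum_comm

lemma finner_self_nonneg {m₁ m₂ : ℕ} (A : Matrix (Fin m₁) (Fin m₂) ℝ) : 0 ≤ finner A A :=
  Finset.sum_nonneg fun _ _ => Finset.sum_nonneg fun _ _ => mul_self_nonneg _

lemma fnorm_transpose {m₁ m₂ : ℕ} (A : Matrix (Fin m₁) (Fin m₂) ℝ) : fnorm Aᵀ = fnorm A := by
  simp only [fnorm, finner, Matrix.transpose_apply]
  rw [Finset.sum_comm]

/-- Orthogonal projection of the columns does not increase the Frobenius norm. -/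
lemma fnorm_proj_mul_le {m₁ m₂ s : ℕ} (U : Matrix (Fin m₁) (Fin s) ℝ) (hU : Uᵀ * U = 1)
    (A : Matrix (Fin m₁) (Fin m₂) ℝ) : fnorm (U * Uᵀ * A) ≤ fnorm A := by
  have hid : U * Uᵀ * (U * Uᵀ) = U * Uᵀ := by
    rw [Matrix.mul_assoc, ← Matrix.mul_assoc Uᵀ, hU, Matrix.one_mul]
  have hproj : Aᵀ * (U * Uᵀ) * (U * Uᵀ * A) = Aᵀ * (U * Uᵀ) * A := by
    rw [← Matrix.mul_assoc, Matrix.mul_assoc Aᵀ, hid]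
  have h := finner_self_nonneg (A - U * Uᵀ * A)
  refine Real.sqrt_le_sqrt ?_
  rw [finner_eq_trace] at h ⊢
  rw [finner_eq_trace]
  simp only [Matrix.transpose_sub, Matrix.transpose_mul, Matrix.transpose_transpose,
    Matrix.sub_mul, Matrix.mul_sub, Matrix.trace_sub, hproj] at h ⊢
  simp only [Matrix.mul_assoc] at h ⊢
  linarith

/-- Orthogonal projection of both columns and rows does not increase the Frobenius norm. -/
lemma fnorm_proj_mul_proj_le {m₁ m₂ s₁ s₂ : ℕ} (U : Matrix (Fin m₁) (Fin s₁) ℝ)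
    (V : Matrix (Fin m₂) (Fin s₂) ℝ) (hU : Uᵀ * U = 1) (hV : Vᵀ * V = 1)
    (A : Matrix (Fin m₁) (Fin m₂) ℝ) : fnorm (U * Uᵀ * A * V * Vᵀ) ≤ fnorm A := by
  rw [← fnorm_transpose]
  have h : (U * Uᵀ * A * V * Vᵀ)ᵀ = V * Vᵀ * (U * Uᵀ * A)ᵀ := by
    simp only [Matrix.transpose_mul, Matrix.transpose_transpose, Matrix.mul_assoc]
  rw [h]
  exact ((fnorm_proj_mul_le V hV _).trans_eq (fnorm_transpose _)).trans (fnorm_proj_mul_le U hU A)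

/-- The entries of a matrix as a vector of Euclidean space. -/
noncomputable def euclideanVec {m₁ m₂ : ℕ} :
    Matrix (Fin m₁) (Fin m₂) ℝ →ₗ[ℝ] EuclideanSpace ℝ (Fin m₁ × Fin m₂) where
  toFun A := WithLp.toLp 2 fun p => A p.1 p.2
  map_add' _ _ := rfl
  map_smul' _ _ := rfl

@[simp]
lemma euclideanVec_apply {m₁ m₂ : ℕ} (A : Matrix (Fin m₁) (Fin m₂) ℝ) (p : Fin m₁ × Fin m₂) :
    euclideanVec A p = A p.1 p.2 :=
  rfl

lemma norm_euclideanVec {m₁ m₂ : ℕ} (A : Matrix (Fin m₁) (Fin m₂) ℝ) :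
    ‖euclideanVec A‖ = fnorm A := by
  rw [EuclideanSpace.norm_eq, fnorm, finner, Fintype.sum_prod_type]
  simp only [Real.norm_eq_abs, sq_abs, euclideanVec_apply, ← sq]

lemma fnorm_add_le {m₁ m₂ : ℕ} (A C : Matrix (Fin m₁) (Fin m₂) ℝ) :
    fnorm (A + C) ≤ fnorm A + fnorm C := by
  simpa only [← norm_euclideanVec, map_add] using norm_add_le _ _

lemma fnorm_sub_rev {m₁ m₂ : ℕ} (A C : Matrix (Fin m₁) (Fin m₂) ℝ) :
    fnorm (A - C) = fnorm (C - A) := by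
  simpa only [← norm_euclideanVec, map_sub] using norm_sub_rev _ _

lemma fnorm_smul {m₁ m₂ : ℕ} {c : ℝ} (hc : 0 ≤ c) (A : Matrix (Fin m₁) (Fin m₂) ℝ) :
    fnorm (c • A) = c * fnorm A := by
  simp only [← norm_euclideanVec, map_smul, norm_smul, Real.norm_of_nonneg hc]

/-- Mean value inequality for a matrix-valued curve whose velocity stays close to a constant. -/
lemma fnorm_sub_sub_smul_le {m₁ m₂ : ℕ} {X X' : ℝ → Matrix (Fin m₁) (Fin m₂) ℝ} {a b : ℝ}
    (hX : ∀ t ∈ Set.Icc a b, ∀ i j, HasDerivAt (fun τ => X τ i j) (X' t i j) t)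
    (G : Matrix (Fin m₁) (Fin m₂) ℝ) {C : ℝ} (hC : ∀ t ∈ Set.Icc a b, fnorm (X' t - G) ≤ C)
    {t : ℝ} (ht : t ∈ Set.Icc a b) :
    fnorm (X t - X a - (t - a) • G) ≤ C * (t - a) := by
  have hderiv : ∀ t ∈ Set.Icc a b,
      HasDerivWithinAt (fun τ => euclideanVec (X τ - τ • G)) (euclideanVec (X' t - G))
        (Set.Icc a b) t := by
    intro t ht
    rw [hasDerivWithinAt_iff_hasFDerivWithinAt, hasFDerivWithinAt_euclidean]
    intro p
    have h := ((hX t ht p.1 p.2).sub ((hasDerivAt_id t).mul_const (G p.1 p.2))).hasDerivWithinAt (s := Set.Icc a b)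
    rw [hasDerivWithinAt_iff_hasFDerivWithinAt] at h
    exact h.congr_fderiv (by ext; simp)
  have h := norm_image_sub_le_of_norm_deriv_le_segment' hderiv
    (fun t ht => (norm_euclideanVec _).trans_le (hC t (Set.Ico_subset_Icc_self ht))) t ht
  rw [← map_sub, norm_euclideanVec] at h
  convert h using 2
  rw [sub_smul]
  abel

theorem stmt_10 {m₁ m₂ s₁ s₂ : ℕ} (L B ε₂ : ℝ) (hL : 0 < L) (hB : 0 ≤ B)
    (hε₂ : 0 ≤ ε₂)
    (F : Matrix (Fin m₁) (Fin m₂) ℝ → ℝ → Matrix (Fin m₁) (Fin m₂) ℝ)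
    (hLip : ∀ Y Z s t, fnorm (F Y s - F Z t) ≤ L * fnorm (Y - Z) + L * |s - t|)
    (hbound : ∀ Y t, fnorm (F Y t) ≤ B)
    (tn Δt : ℝ) (hΔt : 0 ≤ Δt) (hΔtL : Δt ≤ 1 / (2 * L))
    (X : ℝ → Matrix (Fin m₁) (Fin m₂) ℝ)
    (hX : ∀ t ∈ Set.Icc tn (tn + Δt), ∀ i j,
      HasDerivAt (fun τ => X τ i j) (F (X t) t i j) t)
    (Xn : Matrix (Fin m₁) (Fin m₂) ℝ) (hXn : X tn = Xn)
    (U : Matrix (Fin m₁) (Fin s₁) ℝ) (V : Matrix (Fin m₂) (Fin s₂) ℝ)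
    (hU : Uᵀ * U = 1) (hV : Vᵀ * V = 1)
    (hXproj : U * Uᵀ * Xn * V * Vᵀ = Xn)
    (hFproj : U * Uᵀ * F Xn tn * V * Vᵀ = F Xn tn)
    (S : Matrix (Fin s₁) (Fin s₂) ℝ)
    (hfix : S = Uᵀ * (Xn + Δt • F (U * S * Vᵀ) (tn + Δt)) * V)
    (Xn1 : Matrix (Fin m₁) (Fin m₂) ℝ)
    (htrunc : fnorm (Xn1 - U * S * Vᵀ) ≤ ε₂) :
    fnorm (X (tn + Δt) - Xn1) ≤ 4 * Δt ^ 2 * L * (B + 1) + ε₂ := by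
  subst hXn
  set W := U * S * Vᵀ with hW
  have hstep : W = X tn + Δt • (U * Uᵀ * F W (tn + Δt) * V * Vᵀ) := by
    conv_lhs => rw [hW, hfix]
    conv_rhs => enter [1]; rw [← hXproj]
    simp only [Matrix.mul_add, Matrix.add_mul, Matrix.mul_smul, Matrix.smul_mul, Matrix.mul_assoc]
  have hWX : fnorm (W - X tn) ≤ Δt * B := by
    rw [sub_eq_of_eq_add' hstep, fnorm_smul hΔt]
    exact mul_le_mul_of_nonneg_left
      ((fnorm_proj_mul_proj_le U V hU hV _).trans (hbound _ _)) hΔt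
  have hXt : ∀ t ∈ Set.Icc tn (tn + Δt), fnorm (X t - X tn) ≤ Δt * B := by
    intro t ht
    have h := fnorm_sub_sub_smul_le hX 0 (fun t _ => by simpa using hbound (X t) t) ht
    rw [smul_zero, sub_zero] at h
    nlinarith [ht.2]
  have hexact : fnorm (X (tn + Δt) - X tn - Δt • F (X tn) tn) ≤ L * (Δt * (B + 1)) * Δt := by
    have h := fnorm_sub_sub_smul_le hX (F (X tn) tn) (C := L * (Δt * (B + 1)))
      (fun t ht => by
        have h₁ := hLip (X t) (X tn) t tn
        rw [abs_of_nonneg (sub_nonneg.2 ht.1)] at h₁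
        nlinarith [hXt t ht, ht.2])
      (Set.right_mem_Icc.2 (le_add_of_nonneg_right hΔt))
    rwa [add_sub_cancel_left] at h
  have hnum : fnorm (X tn + Δt • F (X tn) tn - W) ≤ L * (Δt * (B + 1)) * Δt := by
    have heq : W - (X tn + Δt • F (X tn) tn) =
        Δt • (U * Uᵀ * (F W (tn + Δt) - F (X tn) tn) * V * Vᵀ) := by
      rw [Matrix.mul_sub, Matrix.sub_mul, Matrix.sub_mul, hFproj, smul_sub]
      conv_lhs => rw [hstep]
      abel
    rw [fnorm_sub_rev, heq, fnorm_smul hΔt, mul_comm]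
    refine mul_le_mul_of_nonneg_right ((fnorm_proj_mul_proj_le U V hU hV _).trans ?_) hΔt
    have h := hLip W (X tn) (tn + Δt) tn
    rw [add_sub_cancel_left, abs_of_nonneg hΔt] at h
    nlinarith
  have hsplit : X (tn + Δt) - Xn1 = (X (tn + Δt) - X tn - Δt • F (X tn) tn) +
      (X tn + Δt • F (X tn) tn - W) + (W - Xn1) := by abel
  rw [fnorm_sub_rev] at htrunc
  have h₁ := fnorm_add_le (X (tn + Δt) - X tn - Δt • F (X tn) tn + (X tn + Δt • F (X tn) tn - W))
    (W - Xn1)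
  have h₂ := fnorm_add_le (X (tn + Δt) - X tn - Δt • F (X tn) tn) (X tn + Δt • F (X tn) tn - W)
  rw [← hsplit] at h₁
  have hpos : 0 ≤ Δt ^ 2 * L * (B + 1) := by positivity
  linarith
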